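/- arXiv:1602.05547 — 2 statements merged into one kernel-verified Lean document; each statement's English description precedes it below -/
import Mathlib

section
/- If T is a reachability tree for q(n) in a one-dimensional BVASS that contains a decreasing node (a node v with a strict ancestor u having state(u) = state(v) and counter(u) > counter(v)), then the reachability set of q is infinite. -/
/-- A one-dimensional branching vector addition system with states:
branching transitions `br`, unary transitions `un` with update in `{-1,0,1}`,
and final states `final`. -/
structure BVASS1 (Q : Type) where
  br : Q → Q → Q → Prop
  un : Q → ℤ → Q → Prop
  un_small : ∀ q z p, un q z p → z = -1 ∨ z = 0 ∨ z = 1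
  final : Q → Prop

/-- A finite binary tree with nodes given by a prefix-closed set of words over
`Bool` and labels in `Q × ℕ`. -/
structure BTree (Q : Type) where
  dom : Set (List Bool)
  label : List Bool → Q × ℕ
  finite : dom.Finite
  root_mem : ([] : List Bool) ∈ dom
  prefixClosed : ∀ ⦃u v : List Bool⦄, v ∈ dom → u <+: v → u ∈ dom

/-- `u` is a strict ancestor of `v`. -/
def StrictPrefix (u v : List Bool) : Prop := u <+: v ∧ u ≠ v

/-- `u` is the lowest common ancestor of `v` and `w`. -/
def IsLCA (u v w : List Bool) : Prop :=
  u <+: v ∧ u <+: w ∧ ∀ u', u' <+: v → u' <+: w → u' <+: u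

namespace BTree

variable {Q : Type}

def state (T : BTree Q) (u : List Bool) : Q := (T.label u).1

def counter (T : BTree Q) (u : List Bool) : ℕ := (T.label u).2

def IsLeaf (T : BTree Q) (u : List Bool) : Prop :=
  u ∈ T.dom ∧ ∀ b : Bool, u ++ [b] ∉ T.dom

/-- The subtree of `T` rooted at node `u`. -/
def subtree (T : BTree Q) (u : List Bool) (hu : u ∈ T.dom) : BTree Q where
  dom := {x | u ++ x ∈ T.dom}
  label := fun x => T.label (u ++ x)
  finite := Set.Finite.preimage
    (Function.Injective.injOn fun a b h => by simpa using h) T.finite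
  root_mem := by simpa using hu
  prefixClosed := by
    rintro a c hc ⟨t, rfl⟩
    exact T.prefixClosed hc ⟨t, by simp⟩

/-- All counter values in the tree are at most `j`. -/
def Bounded (T : BTree Q) (j : ℕ) : Prop := ∀ u ∈ T.dom, T.counter u ≤ j

/-- All counter values, except possibly the root's, are at most `j`. -/
def AlmostBounded (T : BTree Q) (j : ℕ) : Prop :=
  ∀ u ∈ T.dom, u ≠ [] → T.counter u ≤ j

/-- A node is increasing if it has a strict ancestor with the same state
and a strictly smaller counter value. -/
def Increasing (T : BTree Q) (v : List Bool) : Prop :=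
  ∃ u ∈ T.dom, StrictPrefix u v ∧ T.state u = T.state v ∧ T.counter u < T.counter v

/-- `u` is the anchor of the increasing node `v`: the maximal strict ancestor of `v`
with the same state and strictly smaller counter value. -/
def IsAnchorOf (T : BTree Q) (u v : List Bool) : Prop :=
  u ∈ T.dom ∧ StrictPrefix u v ∧ T.state u = T.state v ∧ T.counter u < T.counter v ∧
    ∀ u' ∈ T.dom, StrictPrefix u' v → T.state u' = T.state v →
      T.counter u' < T.counter v → u' <+: u

/-- The tree is exclusive: the least common ancestor of any two distinct increasing
leaves is a strict ancestor of at least one of their anchors. -/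
def Exclusive (T : BTree Q) : Prop :=
  ∀ v w, T.IsLeaf v → T.IsLeaf w → T.Increasing v → T.Increasing w → v ≠ w →
    ∀ a b l, T.IsAnchorOf a v → T.IsAnchorOf b w → IsLCA l v w →
      StrictPrefix l a ∨ StrictPrefix l b

end BTree

namespace BVASS1

variable {Q : Type}

/-- `T` is a partial reachability tree of `B`: at every inner node either a
branching transition splits the counter over two children, or a unary transition
changes the counter by `z` along a single-child edge. -/
def IsPRT (B : BVASS1 Q) (T : BTree Q) : Prop :=
  ∀ u ∈ T.dom, ¬ T.IsLeaf u →
    ((u ++ [false] ∈ T.dom ∧ u ++ [true] ∈ T.dom ∧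
        B.br (T.state u) (T.state (u ++ [false])) (T.state (u ++ [true])) ∧
        T.counter u = T.counter (u ++ [false]) + T.counter (u ++ [true])) ∨
     (u ++ [false] ∈ T.dom ∧ u ++ [true] ∉ T.dom ∧
        ∃ z : ℤ, B.un (T.state u) z (T.state (u ++ [false])) ∧
          (T.counter (u ++ [false]) : ℤ) = (T.counter u : ℤ) + z))

/-- `T` is a (full) reachability tree of `B`: a partial reachability tree all of
whose leaves are accepting (final state, counter zero). -/
def IsRT (B : BVASS1 Q) (T : BTree Q) : Prop :=
  B.IsPRT T ∧ ∀ u, T.IsLeaf u → B.final (T.state u) ∧ T.counter u = 0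

/-- The configuration `q(n)` is reachable. -/
def Reachable (B : BVASS1 Q) (q : Q) (n : ℕ) : Prop :=
  ∃ T : BTree Q, B.IsRT T ∧ T.label [] = (q, n)

/-- The reachability set of a control state. -/
def reachSet (B : BVASS1 Q) (q : Q) : Set ℕ := {n | B.Reachable q n}

/-- The configuration `q(n)` is coverable. -/
def Coverable (B : BVASS1 Q) (q : Q) (n : ℕ) : Prop :=
  ∃ m, n ≤ m ∧ B.Reachable q m

/-- `T` is expandable: exclusive, every leaf is accepting or increasing, and every
increasing leaf with its anchor induces a positive residue-reachability instance. -/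
def Expandable (B : BVASS1 Q) (T : BTree Q) : Prop :=
  T.Exclusive ∧
  (∀ v, T.IsLeaf v → (B.final (T.state v) ∧ T.counter v = 0) ∨ T.Increasing v) ∧
  (∀ v u, T.IsLeaf v → T.IsAnchorOf u v →
    ∃ l, B.Reachable (T.state v) l ∧ T.counter v ≤ l ∧
      l ≡ T.counter v [MOD T.counter v - T.counter u])

end BVASS1

namespace BVASS1

variable {Q : Type}

/-- Membership in the domain of a node with given children domains. -/
def nodeDom (D1 D2 : Set (List Bool)) : List Bool → Prop
  | [] => True
  | false :: x => x ∈ D1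
  | true :: x => x ∈ D2

/-- Labels of a node with given children labels. -/
def nodeLabel (c : Q × ℕ) (l1 l2 : List Bool → Q × ℕ) : List Bool → Q × ℕ
  | [] => c
  | false :: x => l1 x
  | true :: x => l2 x

/-- The tree with root label `c`, left subtree `T1`, right part given by `D2`, `l2`. -/
def node (c : Q × ℕ) (T1 : BTree Q) (D2 : Set (List Bool)) (l2 : List Bool → Q × ℕ)
    (hf : D2.Finite) (hp : ∀ ⦃u v : List Bool⦄, v ∈ D2 → u <+: v → u ∈ D2) : BTree Q where
  dom := {x | nodeDom T1.dom D2 x}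
  label := nodeLabel c T1.label l2
  finite := by
    refine Set.Finite.subset (((T1.finite.image (List.cons false)).union
      (hf.image (List.cons true))).union (Set.finite_singleton [])) ?_
    rintro (_ | ⟨_ | _, x⟩) hx
    · simp
    · exact Or.inl (Or.inl ⟨x, hx, rfl⟩)
    · exact Or.inl (Or.inr ⟨x, hx, rfl⟩)
  root_mem := trivial
  prefixClosed := by
    rintro (_ | ⟨b, x⟩) v hv ⟨t, rfl⟩
    · trivial
    · cases b
      · exact T1.prefixClosed (u := x) (v := x ++ t) hv ⟨t, rfl⟩
      · exact hp (u := x) (v := x ++ t) hv ⟨t, rfl⟩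

theorem reach_un (B : BVASS1 Q) {p p' : Q} {m m' : ℕ} {z : ℤ} (h : B.un p z p')
    (hz : (m' : ℤ) = m + z) (hr : B.Reachable p' m') : B.Reachable p m := by
  obtain ⟨T1, ⟨h1, h2⟩, hl⟩ := hr
  refine ⟨node (p, m) T1 ∅ T1.label Set.finite_empty (by simp), ⟨?_, ?_⟩, rfl⟩
  · rintro (_ | ⟨_ | _, x⟩) hx hnl
    · refine Or.inr ⟨T1.root_mem, fun h => h, z, ?_, ?_⟩
      · show B.un p z (T1.label []).1
        rw [hl]; exact h
      · show ((T1.label []).2 : ℤ) = m + z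
        rw [hl]; exact hz
    · refine h1 x hx fun hlf => hnl ⟨hx, fun b => hlf.2 b⟩
    · exact hx.elim
  · rintro (_ | ⟨_ | _, x⟩) hx
    · exact (hx.2 false T1.root_mem).elim
    · exact h2 x ⟨hx.1, fun b => hx.2 b⟩
    · exact hx.1.elim

theorem reach_br (B : BVASS1 Q) {p p1 p2 : Q} {m1 m2 : ℕ} (h : B.br p p1 p2)
    (hr1 : B.Reachable p1 m1) (hr2 : B.Reachable p2 m2) : B.Reachable p (m1 + m2) := by
  obtain ⟨T1, ⟨h1, h2⟩, hl⟩ := hr1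
  obtain ⟨T2, ⟨h3, h4⟩, hl2⟩ := hr2
  refine ⟨node (p, m1 + m2) T1 T2.dom T2.label T2.finite T2.prefixClosed, ⟨?_, ?_⟩, rfl⟩
  · rintro (_ | ⟨_ | _, x⟩) hx hnl
    · refine Or.inl ⟨T1.root_mem, T2.root_mem, ?_, ?_⟩
      · show B.br p (T1.label []).1 (T2.label []).1
        rw [hl, hl2]; exact h
      · show m1 + m2 = (T1.label []).2 + (T2.label []).2
        rw [hl, hl2]
    · exact h1 x hx fun hlf => hnl ⟨hx, fun b => hlf.2 b⟩
    · exact h3 x hx fun hlf => hnl ⟨hx, fun b => hlf.2 b⟩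
  · rintro (_ | ⟨_ | _, x⟩) hx
    · exact (hx.2 false T1.root_mem).elim
    · exact h2 x ⟨hx.1, fun b => hx.2 b⟩
    · exact h4 x ⟨hx.1, fun b => hx.2 b⟩

theorem reach_node (B : BVASS1 Q) {T : BTree Q} (hT : B.IsRT T) {u : List Bool}
    (hu : u ∈ T.dom) : B.Reachable (T.state u) (T.counter u) := by
  have key : ∀ x, (T.subtree u hu).IsLeaf x ↔ T.IsLeaf (u ++ x) := by
    intro x
    simp [BTree.IsLeaf, BTree.subtree]
  refine ⟨T.subtree u hu, ⟨?_, ?_⟩, ?_⟩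
  · intro x hx hnl
    rw [key] at hnl
    have := hT.1 (u ++ x) hx hnl
    simpa [BTree.subtree, BTree.state, BTree.counter] using this
  · intro x hx
    exact hT.2 _ ((key x).1 hx)
  · simp [BTree.subtree, BTree.state, BTree.counter]

theorem reach_lift (B : BVASS1 Q) {T : BTree Q} (hT : B.IsRT T) (d : ℕ) (w : List Bool) :
    ∀ u : List Bool, u ++ w ∈ T.dom →
      B.Reachable (T.state (u ++ w)) (T.counter (u ++ w) + d) →
      B.Reachable (T.state u) (T.counter u + d) := by
  induction w with
  | nil => intro u _ h; simpa using h
  | cons b w ih =>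
    intro u hmem h
    have e : u ++ b :: w = (u ++ [b]) ++ w := by simp
    rw [e] at hmem h
    have hb := ih _ hmem h
    have hbm : u ++ [b] ∈ T.dom := T.prefixClosed hmem ⟨w, rfl⟩
    have hum : u ∈ T.dom := T.prefixClosed hbm ⟨[b], rfl⟩
    rcases hT.1 u hum (fun hl => hl.2 b hbm) with ⟨hf, ht, hbr, hcnt⟩ | ⟨hf, ht, z, hun, hz⟩
    · cases b
      · have := B.reach_br hbr hb (B.reach_node hT ht)
        rwa [hcnt, add_right_comm]
      · have := B.reach_br hbr (B.reach_node hT hf) hb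
        rwa [hcnt, add_assoc]
    · cases b
      · exact B.reach_un hun (by push_cast; linarith) hb
      · exact (ht hbm).elim

end BVASS1

/-- A reachability tree containing a decreasing node witnesses unboundedness. -/
theorem stmt4 {Q : Type} (B : BVASS1 Q) (T : BTree Q) (q : Q) (n : ℕ)
    (hT : B.IsRT T) (hroot : T.label [] = (q, n))
    (u v : List Bool) (hu : u ∈ T.dom) (hv : v ∈ T.dom)
    (huv : StrictPrefix u v) (hs : T.state u = T.state v)
    (hc : T.counter v < T.counter u) :
    (B.reachSet q).Infinite := by
  obtain ⟨⟨w, rfl⟩, -⟩ := huv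
  obtain ⟨e, he⟩ := Nat.exists_eq_add_of_lt hc
  have hk : ∀ k : ℕ, B.Reachable (T.state u) (T.counter u + k * (e + 1)) := by
    intro k
    induction k with
    | zero => simpa using B.reach_node hT hu
    | succ k ih =>
      refine B.reach_lift hT _ w u hv ?_
      rw [← hs]
      convert ih using 1
      rw [he]; ring
  have hr : ∀ k : ℕ, n + k * (e + 1) ∈ B.reachSet q := by
    intro k
    have := B.reach_lift hT (k * (e + 1)) u [] (by simpa using hu) (by simpa using hk k)
    simpa [BVASS1.reachSet, BTree.state, BTree.counter, hroot] using this
  refine Set.infinite_of_injective_forall_mem (f := fun k : ℕ => n + k * (e + 1)) ?_ hr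
  intro a b hab
  simpa using hab
end

section
/- A configuration q(n) of a one-dimensional BVASS B = (Q, Δ, F) is reachable if and only if there exists an expandable (2·|Q| + n)-bounded partial reachability tree whose root is labelled q(n). -/
section Helpers

variable {Q : Type}

/-- Glue one or two trees below a new root. -/
def mkNode (l : Q × ℕ) (T0 T1 : BTree Q) (R : Prop) : BTree Q where
  dom := {x | x = [] ∨ (∃ y ∈ T0.dom, x = false :: y) ∨ (R ∧ ∃ y ∈ T1.dom, x = true :: y)}
  label := fun x => match x with
    | [] => l
    | false :: y => T0.label y
    | true :: y => T1.label y
  finite := by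
    have h : ({[]} ∪ (List.cons false '' T0.dom) ∪ (List.cons true '' T1.dom)).Finite :=
      ((Set.finite_singleton _).union (T0.finite.image _)).union (T1.finite.image _)
    refine h.subset ?_
    rintro x (rfl | ⟨y, hy, rfl⟩ | ⟨_, y, hy, rfl⟩) <;> simp [*]
  root_mem := Or.inl rfl
  prefixClosed := by
    rintro u v hv huv
    rcases u with _ | ⟨b, u⟩
    · exact Or.inl rfl
    · obtain ⟨t, rfl⟩ := huv
      rcases hv with h | ⟨y, hy, h⟩ | ⟨hR, y, hy, h⟩
      · simp at h
      · simp only [List.cons_append, List.cons.injEq] at h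
        obtain ⟨rfl, rfl⟩ := h
        exact Or.inr (Or.inl ⟨u, T0.prefixClosed hy ⟨t, rfl⟩, rfl⟩)
      · simp only [List.cons_append, List.cons.injEq] at h
        obtain ⟨rfl, rfl⟩ := h
        exact Or.inr (Or.inr ⟨hR, u, T1.prefixClosed hy ⟨t, rfl⟩, rfl⟩)

lemma mkNode_false (l : Q × ℕ) (T0 T1 : BTree Q) (R : Prop) (y : List Bool) :
    false :: y ∈ (mkNode l T0 T1 R).dom ↔ y ∈ T0.dom := by
  simp [mkNode]

lemma mkNode_true (l : Q × ℕ) (T0 T1 : BTree Q) (R : Prop) (y : List Bool) :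
    true :: y ∈ (mkNode l T0 T1 R).dom ↔ R ∧ y ∈ T1.dom := by
  simp [mkNode]

lemma mkNode_isRT (B : BVASS1 Q) (l : Q × ℕ) (T0 T1 : BTree Q) (R : Prop)
    (h0 : B.IsRT T0) (h1 : B.IsRT T1)
    (h : (R ∧ B.br l.1 (T0.label []).1 (T1.label []).1 ∧
          l.2 = (T0.label []).2 + (T1.label []).2) ∨
        (¬ R ∧ ∃ z : ℤ, B.un l.1 z (T0.label []).1 ∧
          ((T0.label []).2 : ℤ) = (l.2 : ℤ) + z)) :
    B.IsRT (mkNode l T0 T1 R) := by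
  have r0 := T0.root_mem
  have r1 := T1.root_mem
  constructor
  · intro u hu hl
    rcases u with _ | ⟨b, u⟩
    · simp only [List.nil_append, mkNode_false, mkNode_true, r0, r1, and_true, true_and]
      exact h
    · cases b
      · have hu' := (mkNode_false ..).1 hu
        have := h0.1 u hu' (fun hh => hl ⟨hu, fun b => by
          simpa only [List.cons_append, mkNode_false] using hh.2 b⟩)
        simp only [List.cons_append, mkNode_false]
        exact this
      · have hu' := (mkNode_true ..).1 hu
        have := h1.1 u hu'.2 (fun hh => hl ⟨hu, fun b => by
          simpa only [List.cons_append, mkNode_true, hu'.1, true_and] using hh.2 b⟩)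
        simp only [List.cons_append, mkNode_true, hu'.1, true_and]
        exact this
  · intro u hu
    rcases u with _ | ⟨b, u⟩
    · exact absurd ((mkNode_false l T0 T1 R []).2 r0) (hu.2 false)
    · cases b
      · exact h0.2 u ⟨(mkNode_false ..).1 hu.1, fun b => by
          simpa only [List.cons_append, mkNode_false] using hu.2 b⟩
      · have hu' := (mkNode_true ..).1 hu.1
        exact h1.2 u ⟨hu'.2, fun b => by
          simpa only [List.cons_append, mkNode_true, hu'.1, true_and] using hu.2 b⟩

lemma reach_leaf (B : BVASS1 Q) (q : Q) (h : B.final q) : B.Reachable q 0 := by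
  refine ⟨⟨{[]}, fun _ => (q, 0), Set.finite_singleton _, rfl, ?_⟩, ⟨?_, ?_⟩, rfl⟩
  · rintro u v rfl huv
    exact List.prefix_nil.1 huv
  · rintro u rfl hl
    exact absurd ⟨rfl, fun b => by simp⟩ hl
  · rintro u -
    exact ⟨h, rfl⟩

lemma reach_un (B : BVASS1 Q) (q p : Q) (n m : ℕ) (z : ℤ) (h : B.un q z p)
    (hz : (m : ℤ) = n + z) (hr : B.Reachable p m) : B.Reachable q n := by
  obtain ⟨T, hT, hl⟩ := hr
  refine ⟨mkNode (q, n) T T False, mkNode_isRT B _ _ _ _ hT hT (Or.inr ?_), rfl⟩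
  rw [hl]
  exact ⟨id, z, h, hz⟩

lemma reach_br (B : BVASS1 Q) (q p p' : Q) (n m m' : ℕ) (h : B.br q p p')
    (hz : n = m + m') (hr : B.Reachable p m) (hr' : B.Reachable p' m') :
    B.Reachable q n := by
  obtain ⟨T, hT, hl⟩ := hr
  obtain ⟨T', hT', hl'⟩ := hr'
  refine ⟨mkNode (q, n) T T' True, mkNode_isRT B _ _ _ _ hT hT' (Or.inl ?_), rfl⟩
  rw [hl, hl']
  exact ⟨trivial, h, hz⟩

lemma exists_lca (v w : List Bool) : ∃ l, IsLCA l v w := by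
  induction v generalizing w with
  | nil => exact ⟨[], by simp, by simp, fun u h _ => h⟩
  | cons b v ih =>
    rcases w with _ | ⟨c, w⟩
    · exact ⟨[], by simp, by simp, fun u _ h => h⟩
    · by_cases hbc : b = c
      · subst hbc
        obtain ⟨l, h1, h2, h3⟩ := ih w
        refine ⟨b :: l, by simpa using h1, by simpa using h2, ?_⟩
        rintro (_ | ⟨d, u⟩) hu hu'
        · simp
        · simp only [List.cons_prefix_cons] at hu hu' ⊢
          exact ⟨hu.1, h3 u hu.2 hu'.2⟩
      · refine ⟨[], by simp, by simp, ?_⟩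
        rintro (_ | ⟨d, u⟩) hu hu'
        · simp
        · simp only [List.cons_prefix_cons] at hu hu'
          exact absurd (hu.1.symm.trans hu'.1) hbc

lemma strictPrefix_length {u v : List Bool} (h : StrictPrefix u v) : u.length < v.length := by
  rcases Nat.lt_or_ge u.length v.length with h' | h'
  · exact h'
  · exact absurd (h.1.eq_of_length (le_antisymm h.1.length_le h')) h.2

lemma strictPrefix_next {u v : List Bool} (h : StrictPrefix u v) :
    ∃ b : Bool, u ++ [b] <+: v := by
  obtain ⟨⟨t, rfl⟩, hne⟩ := h
  rcases t with _ | ⟨b, t⟩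
  · simp at hne
  · exact ⟨b, t, by simp⟩

lemma prefix_total {u v w : List Bool} (hu : u <+: w) (hv : v <+: w) :
    u <+: v ∨ StrictPrefix v u := by
  rcases le_or_gt u.length v.length with h | h
  · exact Or.inl (List.prefix_of_prefix_length_le hu hv h)
  · refine Or.inr ⟨List.prefix_of_prefix_length_le hv hu h.le, ?_⟩
    rintro rfl
    exact lt_irrefl _ h

lemma strict_snoc {u w : List Bool} {b : Bool} (h : StrictPrefix w (u ++ [b])) : w <+: u := by
  have := strictPrefix_length h
  simp only [List.length_append, List.length_singleton] at this
  exact List.prefix_of_prefix_length_le h.1 (List.prefix_append _ _) (by omega)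

lemma snoc_strict (u : List Bool) (b : Bool) : StrictPrefix u (u ++ [b]) :=
  ⟨List.prefix_append _ _, by simp⟩

lemma snoc_unique {u v : List Bool} {b c : Bool} (h : u ++ [b] <+: v) (h' : u ++ [c] <+: v) :
    b = c := by
  have := (List.prefix_of_prefix_length_le h h' (by simp)).eq_of_length (by simp)
  simpa using this

lemma exists_anchor (T : BTree Q) (v : List Bool) (h : T.Increasing v) :
    ∃ a, T.IsAnchorOf a v := by
  classical
  let S : Set (List Bool) := {u | u ∈ T.dom ∧ StrictPrefix u v ∧ T.state u = T.state v ∧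
    T.counter u < T.counter v}
  have hS : S.Finite := T.finite.subset fun u hu => hu.1
  have hne : S.Nonempty := by
    obtain ⟨u, h1, h2, h3, h4⟩ := h
    exact ⟨u, h1, h2, h3, h4⟩
  obtain ⟨a, ha, hmax⟩ := Set.exists_max_image S List.length hS hne
  refine ⟨a, ha.1, ha.2.1, ha.2.2.1, ha.2.2.2, ?_⟩
  intro u' h1 h2 h3 h4
  exact List.prefix_of_prefix_length_le h2.1 ha.2.1.1 (hmax u' ⟨h1, h2, h3, h4⟩)

/-- `v` is a leaf below `u` whose anchor is strictly above `u`. -/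
def OpenAt (T : BTree Q) (u v : List Bool) : Prop :=
  T.IsLeaf v ∧ u <+: v ∧ ∃ a, T.IsAnchorOf a v ∧ StrictPrefix a u

lemma anchor_increasing {T : BTree Q} {a v : List Bool} (h : T.IsAnchorOf a v) :
    T.Increasing v := ⟨a, h.1, h.2.1, h.2.2.1, h.2.2.2.1⟩

lemma open_unique {T : BTree Q} (hE : T.Exclusive) {u v w : List Bool} {b c : Bool}
    (hv : OpenAt T (u ++ [b]) v) (hw : OpenAt T (u ++ [c]) w) : v = w := by
  by_contra hne
  obtain ⟨hv1, hv2, a, ha, hau⟩ := hv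
  obtain ⟨hw1, hw2, a', ha', hau'⟩ := hw
  obtain ⟨l, hl⟩ := exists_lca v w
  have hul : u <+: l := hl.2.2 u ((List.prefix_append _ _).trans hv2)
    ((List.prefix_append _ _).trans hw2)
  have h1 := (strict_snoc hau).length_le
  have h2 := (strict_snoc hau').length_le
  have h3 := hul.length_le
  rcases hE v w hv1 hw1 (anchor_increasing ha) (anchor_increasing ha') hne a a' l ha ha' hl
    with h | h
  · have := strictPrefix_length h
    omega
  · have := strictPrefix_length h
    omega

lemma reach_node (B : BVASS1 Q) (T : BTree Q) (hP : B.IsPRT T) (hE : B.Expandable T)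
    (N : ℕ) (hN : ∀ u ∈ T.dom, u.length ≤ N) (k : ℕ) :
    ∀ u ∈ T.dom, N + 1 ≤ u.length + k →
      ((∀ v, ¬ OpenAt T u v) → B.Reachable (T.state u) (T.counter u)) ∧
      (∀ v, OpenAt T u v → ∀ j, B.Reachable (T.state v) (T.counter v + j) →
        B.Reachable (T.state u) (T.counter u + j)) := by
  induction k with
  | zero =>
    intro u hu h
    have := hN u hu
    omega
  | succ k ih =>
    intro u hu hk
    by_cases hl : T.IsLeaf u
    · constructor
      · intro hno
        rcases hE.2.1 u hl with h | h
        · rw [h.2]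
          exact reach_leaf B _ h.1
        · obtain ⟨a, ha⟩ := exists_anchor T u h
          exact absurd ⟨hl, List.prefix_refl _, a, ha, ha.2.1⟩ (hno u)
      · intro v hv j hj
        by_cases huv : u = v
        · rw [huv]
          exact hj
        · obtain ⟨b, hb⟩ := strictPrefix_next ⟨hv.2.1, huv⟩
          exact absurd (T.prefixClosed hv.1.1 hb) (hl.2 b)
    · have down : ∀ v, OpenAt T u v → ∃ b, OpenAt T (u ++ [b]) v := by
        rintro v ⟨h1, h2, a, h3, h4⟩
        have huv : u ≠ v := fun h => hl (h ▸ h1)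
        obtain ⟨b, hb⟩ := strictPrefix_next ⟨h2, huv⟩
        exact ⟨b, h1, hb, a, h3, h4.1.trans (List.prefix_append _ _), fun h => by
          have := strictPrefix_length h4
          rw [h] at this
          simp at this⟩
      have ihc : ∀ b, u ++ [b] ∈ T.dom → _ := fun b hb => ih (u ++ [b]) hb (by
        simp only [List.length_append, List.length_singleton]
        omega)
      by_cases hex : ∃ b v, OpenAt T (u ++ [b]) v
      · obtain ⟨b, v, hv⟩ := hex
        have mono : ∀ j, B.Reachable (T.state v) (T.counter v + j) →
            B.Reachable (T.state u) (T.counter u + j) := by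
          intro j hj
          have hoth : ∀ c, c ≠ b → ∀ w, ¬ OpenAt T (u ++ [c]) w := by
            intro c hc w hw
            have := open_unique hE.1 hv hw
            subst this
            exact hc (snoc_unique hw.2.1 hv.2.1)
          have hbd := T.prefixClosed hv.1.1 hv.2.1
          have hb := (ihc b hbd).2 v hv j hj
          rcases hP u hu hl with ⟨h0, h1, hbr, hc⟩ | ⟨h0, h1, z, hun, hc⟩
          · cases b
            · exact reach_br B _ _ _ _ _ _ hbr (by omega) hb
                ((ihc true h1).1 (hoth true (by simp)))
            · exact reach_br B _ _ _ _ _ _ hbr (by omega)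
                ((ihc false h0).1 (hoth false (by simp))) hb
          · cases b
            · exact reach_un B _ _ _ _ z hun (by push_cast; omega) hb
            · exact absurd hbd h1
        constructor
        · intro hno
          obtain ⟨hv1, hv2, a, ha, hau⟩ := hv
          have hau' := strict_snoc hau
          have hau2 : a = u := by
            by_contra hne
            exact hno v ⟨hv1, (List.prefix_append _ _).trans hv2, a, ha, hau', hne⟩
          subst hau2
          obtain ⟨l, hl1, hl2, hl3⟩ := hE.2.2 v a hv1 ha
          have hst := ha.2.2.1
          have hlt := ha.2.2.2.1
          obtain ⟨d, hd⟩ : ∃ d, T.counter v = T.counter a + d := ⟨_, (by omega : _ = _ + (T.counter v - T.counter a))⟩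
          have hdd : T.counter v - T.counter a = d := by omega
          rw [hdd] at hl3
          obtain ⟨m, hm⟩ := (Nat.modEq_iff_dvd' hl2).1 hl3.symm
          have key : ∀ m, B.Reachable (T.state a) (T.counter a + d * m) →
              B.Reachable (T.state a) (T.counter a) := by
            intro m
            induction m with
            | zero => intro h; simpa using h
            | succ m ihm =>
              intro h
              refine ihm (mono _ ?_)
              rw [← hst, hd]
              convert h using 1
              ring
          refine key (m + 1) ?_
          rw [hst]
          convert hl1 using 1
          rw [mul_add]
          omega
        · intro w hw
          obtain ⟨c, hc⟩ := down w hw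
          have := open_unique hE.1 hv hc
          subst this
          exact mono
      · push Not at hex
        constructor
        · intro _
          rcases hP u hu hl with ⟨h0, h1, hbr, hc⟩ | ⟨h0, h1, z, hun, hc⟩
          · exact reach_br B _ _ _ _ _ _ hbr hc ((ihc false h0).1 (hex false))
              ((ihc true h1).1 (hex true))
          · exact reach_un B _ _ _ _ z hun hc ((ihc false h0).1 (hex false))
        · intro v hv
          obtain ⟨b, hb⟩ := down v hv
          exact absurd hb (hex b v)

lemma reach_of_expandable (B : BVASS1 Q) (T : BTree Q) (hP : B.IsPRT T) (hE : B.Expandable T) :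
    B.Reachable (T.state []) (T.counter []) := by
  obtain ⟨N, hN⟩ := (T.finite.image List.length).bddAbove
  refine (reach_node B T hP hE N (fun u hu => hN ⟨u, hu, rfl⟩) (N + 1) [] T.root_mem
    (by simp)).1 ?_
  rintro v ⟨_, _, a, _, ha⟩
  exact ha.2 (List.prefix_nil.1 ha.1)

/-- The direction of the heavy child of `w`. -/
noncomputable def heavy (R : BTree Q) (w : List Bool) : Bool :=
  open Classical in
  decide (w ++ [true] ∈ R.dom ∧ R.counter (w ++ [false]) < R.counter (w ++ [true]))

/-- The path from `u` down to `v` only uses heavy edges. -/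
def HeavyPath (R : BTree Q) (u v : List Bool) : Prop :=
  u <+: v ∧ ∀ w b, u <+: w → w ++ [b] <+: v → b = heavy R w

/-- Nodes at which the tree is cut. -/
def Cut (R : BTree Q) (v : List Bool) : Prop :=
  ∃ u, StrictPrefix u v ∧ HeavyPath R u v ∧ R.state u = R.state v ∧ R.counter u < R.counter v

/-- The tree cut off below all cut nodes. -/
def cutTree (R : BTree Q) : BTree Q where
  dom := {v | v ∈ R.dom ∧ ∀ w, StrictPrefix w v → ¬ Cut R w}
  label := R.label
  finite := R.finite.subset fun _ h => h.1
  root_mem := ⟨R.root_mem, fun w hw => absurd (List.prefix_nil.1 hw.1) hw.2⟩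
  prefixClosed := by
    rintro u v hv huv
    refine ⟨R.prefixClosed hv.1 huv, fun w hw => hv.2 w ⟨hw.1.trans huv, ?_⟩⟩
    rintro rfl
    have := strictPrefix_length hw
    have := huv.length_le
    omega

lemma cutTree_child (R : BTree Q) {u : List Bool} (hu : u ∈ (cutTree R).dom) (hc : ¬ Cut R u)
    (b : Bool) : u ++ [b] ∈ (cutTree R).dom ↔ u ++ [b] ∈ R.dom := by
  refine ⟨fun h => h.1, fun h => ⟨h, fun w hw => ?_⟩⟩
  by_cases hwu : w = u
  · rwa [hwu]
  · exact hu.2 w ⟨strict_snoc hw, hwu⟩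

lemma cutTree_leaf (R : BTree Q) {u : List Bool} :
    (cutTree R).IsLeaf u ↔ u ∈ (cutTree R).dom ∧ (Cut R u ∨ R.IsLeaf u) := by
  constructor
  · rintro ⟨h1, h2⟩
    refine ⟨h1, ?_⟩
    by_cases hc : Cut R u
    · exact Or.inl hc
    · exact Or.inr ⟨h1.1, fun b => by rw [← cutTree_child R h1 hc]; exact h2 b⟩
  · rintro ⟨h1, h2⟩
    refine ⟨h1, fun b hb => ?_⟩
    rcases h2 with h2 | h2
    · exact hb.2 u (snoc_strict u b) h2
    · exact h2.2 b hb.1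

lemma cutTree_isPRT (B : BVASS1 Q) (R : BTree Q) (hR : B.IsPRT R) : B.IsPRT (cutTree R) := by
  intro u hu hl
  rw [cutTree_leaf] at hl
  have hc : ¬ Cut R u := fun h => hl ⟨hu, Or.inl h⟩
  rw [cutTree_child R hu hc, cutTree_child R hu hc]
  exact hR u hu.1 fun h => hl ⟨hu, Or.inr h⟩

lemma subtree_isRT (B : BVASS1 Q) (R : BTree Q) (hR : B.IsRT R) (u : List Bool)
    (hu : u ∈ R.dom) : B.IsRT (R.subtree u hu) := by
  have hleaf : ∀ x, (R.subtree u hu).IsLeaf x ↔ R.IsLeaf (u ++ x) := by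
    intro x
    simp [BTree.IsLeaf, BTree.subtree]
  constructor
  · intro x hx hl
    rw [hleaf] at hl
    have := hR.1 (u ++ x) hx hl
    simp only [List.append_assoc] at this
    exact this
  · intro x hx
    exact hR.2 _ ((hleaf x).1 hx)

lemma reach_of_mem (B : BVASS1 Q) (R : BTree Q) (hR : B.IsRT R) (u : List Bool)
    (hu : u ∈ R.dom) : B.Reachable (R.state u) (R.counter u) :=
  ⟨R.subtree u hu, subtree_isRT B R hR u hu, by
    simp [BTree.subtree, BTree.state, BTree.counter]⟩

lemma cutTree_exclusive (B : BVASS1 Q) (R : BTree Q) (hR : B.IsRT R) :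
    (cutTree R).Exclusive := by
  have hcut : ∀ v, (cutTree R).IsLeaf v → (cutTree R).Increasing v → Cut R v := by
    intro v hv hi
    rcases ((cutTree_leaf R).1 hv).2 with h | h
    · exact h
    · obtain ⟨u, _, _, _, hlt⟩ := hi
      have h0 : (cutTree R).counter v = 0 := (hR.2 v h).2
      omega
  have hheavy : ∀ v a, (cutTree R).IsLeaf v → (cutTree R).IsAnchorOf a v → HeavyPath R a v := by
    intro v a hv ha
    obtain ⟨u, h1, h2, h3, h4⟩ := hcut v hv (anchor_increasing ha)
    have hua : u <+: a := ha.2.2.2.2 u ((cutTree R).prefixClosed hv.1 h1.1) h1 h3 h4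
    exact ⟨ha.2.1.1, fun w b hw hb => h2.2 w b (hua.trans hw) hb⟩
  have hnp : ∀ v w, (cutTree R).IsLeaf v → (cutTree R).IsLeaf w → v ≠ w → ¬ v <+: w := by
    intro v w hv hw hne hp
    obtain ⟨b, hb⟩ := strictPrefix_next ⟨hp, hne⟩
    exact hv.2 b ((cutTree R).prefixClosed hw.1 hb)
  intro v w hv hw _ _ hne a b l ha hb hl
  have hlv : l ≠ v := fun h => hnp v w hv hw hne (h ▸ hl.2.1)
  have hlw : l ≠ w := fun h => hnp w v hw hv (Ne.symm hne) (h ▸ hl.1)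
  obtain ⟨b1, hb1⟩ := strictPrefix_next ⟨hl.1, hlv⟩
  obtain ⟨b2, hb2⟩ := strictPrefix_next ⟨hl.2.1, hlw⟩
  rcases prefix_total ha.2.1.1 hl.1 with h | h
  · rcases prefix_total hb.2.1.1 hl.2.1 with h' | h'
    · exfalso
      have e1 := (hheavy v a hv ha).2 l b1 h hb1
      have e2 := (hheavy w b hw hb).2 l b2 h' hb2
      rw [← e1] at e2
      subst e2
      have := (hl.2.2 _ hb1 hb2).length_le
      simp at this
    · exact Or.inr h'
  · exact Or.inl h

lemma cutTree_expandable (B : BVASS1 Q) (R : BTree Q) (hR : B.IsRT R) :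
    B.Expandable (cutTree R) := by
  refine ⟨cutTree_exclusive B R hR, ?_, ?_⟩
  · intro v hv
    obtain ⟨h1, h | h⟩ := (cutTree_leaf R).1 hv
    · obtain ⟨u, h2, h3, h4, h5⟩ := h
      exact Or.inr ⟨u, (cutTree R).prefixClosed h1 h2.1, h2, h4, h5⟩
    · exact Or.inl (hR.2 v h)
  · intro v u hv _
    exact ⟨(cutTree R).counter v, reach_of_mem B R hR v hv.1.1, le_rfl, Nat.ModEq.refl _⟩

lemma step_le (B : BVASS1 Q) (R : BTree Q) (hR : B.IsPRT R) (w : List Bool) (b : Bool)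
    (hw : w ++ [b] ∈ R.dom) :
    R.counter (w ++ [b]) ≤ R.counter w + 1 ∧
      (b ≠ heavy R w → 2 * R.counter (w ++ [b]) ≤ R.counter w) := by
  have hwd : w ∈ R.dom := R.prefixClosed hw (List.prefix_append _ _)
  rcases hR w hwd (fun h => h.2 b hw) with ⟨h0, h1, _, hc⟩ | ⟨h0, h1, z, hun, hc⟩
  · by_cases hlt : R.counter (w ++ [false]) < R.counter (w ++ [true])
    · have : heavy R w = true := by simp [heavy, h1, hlt]
      rw [this]
      cases b <;> simp <;> omega
    · have : heavy R w = false := by simp [heavy, hlt]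
      rw [this]
      cases b <;> simp <;> omega
  · have : heavy R w = false := by simp [heavy, h1]
    rw [this]
    cases b
    · have := B.un_small _ _ _ hun
      simp
      omega
    · exact absurd hw h1

lemma pigeon [Fintype Q] (f : ℕ → ℕ) (s : ℕ → Q) (N : ℕ)
    (hstep : ∀ t < N, f (t + 1) ≤ f t + 1) (hN : f 0 + Fintype.card Q < f N) :
    ∃ i j, i < j ∧ j < N ∧ s i = s j ∧ f i < f j := by
  classical
  have hex : ∀ k : Fin (Fintype.card Q + 1), ∃ t, t < N ∧ f t = f 0 + k ∧
      ∀ t' < t, f t' < f 0 + k := by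
    intro k
    have hk := k.2
    have hh : ∃ t, f 0 + k ≤ f t := ⟨N, by omega⟩
    have h1 := Nat.find_spec hh
    have h2 : ∀ t' < Nat.find hh, f t' < f 0 + k := fun t' ht' => by
      have := Nat.find_min hh ht'
      omega
    have h3 : Nat.find hh ≤ N := Nat.find_min' hh (by omega)
    generalize Nat.find hh = t at *
    have h4 : f t = f 0 + k := by
      rcases t with _ | t
      · omega
      · have := h2 t (by omega)
        have := hstep t (by omega)
        omega
    refine ⟨t, ?_, h4, h2⟩
    rcases Nat.lt_or_ge t N with h | h
    · exact h
    · have : t = N := by omega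
      subst this
      omega
  choose t ht using hex
  obtain ⟨i, j, hne, hij⟩ := Fintype.exists_ne_map_eq_of_card_lt (fun k => s (t k)) (by simp)
  have aux : ∀ i j : Fin (Fintype.card Q + 1), i < j → s (t i) = s (t j) →
      ∃ i j, i < j ∧ j < N ∧ s i = s j ∧ f i < f j := by
    intro i j hlt he
    have hlt' : (i : ℕ) < j := hlt
    have hf : f (t i) < f (t j) := by
      rw [(ht i).2.1, (ht j).2.1]
      omega
    refine ⟨t i, t j, ?_, (ht j).1, he, hf⟩
    by_contra hge
    rcases Nat.lt_or_ge (t j) (t i) with h | h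
    · have := (ht i).2.2 _ h
      have := (ht j).2.1
      omega
    · have : t i = t j := by omega
      rw [this] at hf
      omega
  rcases lt_or_gt_of_ne hne with h | h
  · exact aux i j h hij
  · exact aux j i h hij.symm

lemma heavy_bound [Fintype Q] (B : BVASS1 Q) (R : BTree Q) (hR : B.IsPRT R) (u v : List Bool)
    (hv : v ∈ (cutTree R).dom) (huv : HeavyPath R u v) :
    R.counter v ≤ R.counter u + Fintype.card Q := by
  by_contra hlt
  push Not at hlt
  obtain ⟨x, rfl⟩ := huv.1
  have htake : ∀ t, u ++ x.take t <+: u ++ x := fun t => by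
    simpa using List.take_prefix t x
  obtain ⟨i, j, hij, hj, hs, hf⟩ := pigeon (fun t => R.counter (u ++ x.take t))
    (fun t => R.state (u ++ x.take t)) x.length (by
      intro t ht
      have e : u ++ x.take (t + 1) = (u ++ x.take t) ++ [x[t]] := by simp
      have hd : u ++ x.take (t + 1) ∈ R.dom := R.prefixClosed hv.1 (htake _)
      rw [e] at hd ⊢
      exact (step_le B R hR _ _ hd).1) (by simpa using hlt)
  have hjv : StrictPrefix (u ++ x.take j) (u ++ x) := by
    refine ⟨htake j, fun h => ?_⟩
    have := congrArg List.length h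
    simp at this
    omega
  refine hv.2 _ hjv ⟨u ++ x.take i, ⟨?_, ?_⟩, ⟨?_, ?_⟩, hs, hf⟩
  · simpa using List.take_prefix_take_left hij.le
  · intro h
    have := congrArg List.length h
    simp at this
    omega
  · simpa using List.take_prefix_take_left hij.le
  · intro w b hw hb
    exact huv.2 w b ((List.prefix_append _ _).trans hw) (hb.trans (htake j))

lemma cutTree_start [Fintype Q] (B : BVASS1 Q) (R : BTree Q) (hR : B.IsPRT R) (v : List Bool) :
    v ∈ (cutTree R).dom → ∃ u, HeavyPath R u v ∧
      R.counter u ≤ max (R.counter []) (Fintype.card Q) := by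
  induction v using List.reverseRecOn with
  | nil =>
    intro _
    exact ⟨[], ⟨List.prefix_refl _, fun w b _ h => by simp at h⟩, le_max_left _ _⟩
  | append_singleton v b ih =>
    intro hvb
    have hv : v ∈ (cutTree R).dom := (cutTree R).prefixClosed hvb (List.prefix_append _ _)
    obtain ⟨u, hu, hc⟩ := ih hv
    have hbd := heavy_bound B R hR u v hv hu
    by_cases hb : b = heavy R v
    · refine ⟨u, ⟨hu.1.trans (List.prefix_append _ _), fun w c hw hc => ?_⟩, hc⟩
      by_cases hwv : w = v
      · subst hwv
        rw [snoc_unique hc (List.prefix_refl _)]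
        exact hb
      · have h1 : w <+: v := strict_snoc ⟨(List.prefix_append _ _).trans hc, fun h => by
          have := hc.length_le
          rw [h] at this
          simp at this⟩
        obtain ⟨d, hd⟩ := strictPrefix_next ⟨h1, hwv⟩
        have := snoc_unique (hd.trans (List.prefix_append v [b])) hc
        subst this
        exact hu.2 w d hw hd
    · refine ⟨v ++ [b], ⟨List.prefix_refl _, fun w c hw hc => ?_⟩, ?_⟩
      · have h1 := hw.length_le
        have h2 := hc.length_le
        simp only [List.length_append, List.length_singleton] at h1 h2
        omega
      · have := (step_le B R hR v b hvb.1).2 hb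
        omega

end Helpers

/-- Small-model characterisation: `q(n)` is reachable iff there is an expandable
`(2|Q|+n)`-bounded partial reachability tree with root label `q(n)`. -/
theorem stmt11 {Q : Type} [Fintype Q] (B : BVASS1 Q) (q : Q) (n : ℕ) :
    B.Reachable q n ↔
      ∃ T : BTree Q, B.IsPRT T ∧ B.Expandable T ∧
        T.Bounded (2 * Fintype.card Q + n) ∧ T.label [] = (q, n) := by
  constructor
  · rintro ⟨R, hR, hl⟩
    refine ⟨cutTree R, cutTree_isPRT B R hR.1, cutTree_expandable B R hR, ?_, hl⟩
    intro v hv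
    obtain ⟨u, hu, hc⟩ := cutTree_start B R hR.1 v hv
    have hb := heavy_bound B R hR.1 u v hv hu
    have h0 : R.counter [] = n := by simp [BTree.counter, hl]
    have : (cutTree R).counter v = R.counter v := rfl
    omega
  · rintro ⟨T, hP, hE, _, hl⟩
    have := reach_of_expandable B T hP hE
    simpa [BTree.state, BTree.counter, hl] using this
end
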